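/- Let δ ∈ (0,1) and X_1 ∈ [0,1]. For m ∈ (0,1), let H(m) = sup_{β ∈ [-1/(1-m), 1/m]} ln(1 + β (X_1 - m)). Then H(m) = ln(X_1/m) for m < X_1 and H(m) = ln((1 - X_1)/(1 - m)) for m > X_1 (and H(X_1) = 0). Consequently the set { m ∈ (0,1) : H(m) ≤ ln(2/δ) } is exactly the interval [ X_1 δ/2, 1 - (1 - X_1) δ/2 ] ∩ (0,1), whose width equals 1 - δ/2. -/

import Mathlib

/-- The extended-real logarithm, with the convention `ln x = -∞` for `x ≤ 0`. -/
noncomputable def elog (x : ℝ) : EReal :=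
  if x ≤ 0 then ⊥ else ((Real.log x : ℝ) : EReal)

theorem elog_mono : Monotone elog := by
  intro x y hxy
  unfold elog
  split_ifs with hx hy
  · exact le_rfl
  · exact bot_le
  · linarith
  · exact EReal.coe_le_coe (Real.log_le_log (by linarith) hxy)

theorem elog_of_pos {x : ℝ} (hx : 0 < x) : elog x = ((Real.log x : ℝ) : EReal) :=
  if_neg hx.not_ge

/-- A betting fraction that maximizes the wealth over `S` attains the supremum of the log-wealth. -/
theorem iSup_elog_one_add_mul_eq {S : Set ℝ} {d b : ℝ} (hb : b ∈ S)
    (hmax : ∀ β ∈ S, β * d ≤ b * d) :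
    (⨆ β ∈ S, elog (1 + β * d)) = elog (1 + b * d) :=
  le_antisymm (iSup₂_le fun β hβ => elog_mono (by linarith [hmax β hβ]))
    (le_iSup₂ (f := fun β (_ : β ∈ S) => elog (1 + β * d)) b hb)

theorem neg_one_div_one_sub_le_one_div {m : ℝ} (hm : m ∈ Set.Ioo (0 : ℝ) 1) :
    -(1 / (1 - m)) ≤ 1 / m := by
  have h₁ : 0 < 1 / (1 - m) := one_div_pos.2 (sub_pos.2 hm.2)
  have h₂ : 0 < 1 / m := one_div_pos.2 hm.1
  linarith

theorem iSup_elog_of_lt {m x : ℝ} (hm : m ∈ Set.Ioo (0 : ℝ) 1) (hmx : m < x) :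
    (⨆ β ∈ Set.Icc (-(1 / (1 - m))) (1 / m), elog (1 + β * (x - m)))
      = ((Real.log (x / m) : ℝ) : EReal) := by
  have hm0 : 0 < m := hm.1
  rw [iSup_elog_one_add_mul_eq (Set.right_mem_Icc.2 (neg_one_div_one_sub_le_one_div hm))
    fun β hβ => mul_le_mul_of_nonneg_right hβ.2 (sub_nonneg.2 hmx.le)]
  have h : 1 + 1 / m * (x - m) = x / m := by field_simp; ring
  rw [h, elog_of_pos (div_pos (hm0.trans hmx) hm0)]

theorem iSup_elog_of_gt {m x : ℝ} (hm : m ∈ Set.Ioo (0 : ℝ) 1) (hxm : x < m) :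
    (⨆ β ∈ Set.Icc (-(1 / (1 - m))) (1 / m), elog (1 + β * (x - m)))
      = ((Real.log ((1 - x) / (1 - m)) : ℝ) : EReal) := by
  have hm1 : 0 < 1 - m := sub_pos.2 hm.2
  rw [iSup_elog_one_add_mul_eq (Set.left_mem_Icc.2 (neg_one_div_one_sub_le_one_div hm))
    fun β hβ => mul_le_mul_of_nonpos_right hβ.1 (sub_nonpos.2 hxm.le)]
  have h : 1 + -(1 / (1 - m)) * (x - m) = (1 - x) / (1 - m) := by field_simp; ring
  rw [h, elog_of_pos (div_pos (by linarith) hm1)]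

theorem iSup_elog_self {x : ℝ} (hx : x ∈ Set.Ioo (0 : ℝ) 1) :
    (⨆ β ∈ Set.Icc (-(1 / (1 - x))) (1 / x), elog (1 + β * (x - x))) = (0 : EReal) := by
  rw [iSup_elog_one_add_mul_eq (Set.right_mem_Icc.2 (neg_one_div_one_sub_le_one_div hx))
    fun β _ => by simp]
  simp [elog_of_pos]

theorem log_div_le_log_div_iff {a b c d : ℝ} (ha : 0 < a) (hb : 0 < b) (hc : 0 < c)
    (hd : 0 < d) : Real.log (a / b) ≤ Real.log (c / d) ↔ a * d ≤ c * b := by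
  rw [Real.log_le_log_iff (div_pos ha hb) (div_pos hc hd), div_le_div_iff₀ hb hd]

/-- With a single sample `X₁ ∈ [0,1]` and
`H(m) = sup_{β ∈ [-1/(1-m), 1/m]} ln(1 + β (X₁ - m))` for `m ∈ (0,1)`:
`H(m) = ln(X₁/m)` for `m < X₁`, `H(m) = ln((1-X₁)/(1-m))` for `m > X₁`, and
`H(X₁) = 0`.  Consequently `{m ∈ (0,1) : H(m) ≤ ln(2/δ)}` equals
`[X₁ δ/2, 1 - (1-X₁) δ/2] ∩ (0,1)`, an interval of width `1 - δ/2`. -/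
theorem one_sample_confidence_interval (δ X₁ : ℝ) (hδ0 : 0 < δ) (hδ1 : δ < 1)
    (hX : X₁ ∈ Set.Icc (0 : ℝ) 1) :
    (∀ m ∈ Set.Ioo (0 : ℝ) 1, m < X₁ →
      (⨆ β ∈ Set.Icc (-(1 / (1 - m))) (1 / m), elog (1 + β * (X₁ - m)))
        = ((Real.log (X₁ / m) : ℝ) : EReal)) ∧
    (∀ m ∈ Set.Ioo (0 : ℝ) 1, X₁ < m →
      (⨆ β ∈ Set.Icc (-(1 / (1 - m))) (1 / m), elog (1 + β * (X₁ - m)))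
        = ((Real.log ((1 - X₁) / (1 - m)) : ℝ) : EReal)) ∧
    (X₁ ∈ Set.Ioo (0 : ℝ) 1 →
      (⨆ β ∈ Set.Icc (-(1 / (1 - X₁))) (1 / X₁), elog (1 + β * (X₁ - X₁)))
        = (0 : EReal)) ∧
    ({m ∈ Set.Ioo (0 : ℝ) 1 |
        (⨆ β ∈ Set.Icc (-(1 / (1 - m))) (1 / m), elog (1 + β * (X₁ - m)))
          ≤ ((Real.log (2 / δ) : ℝ) : EReal)}
      = Set.Icc (X₁ * δ / 2) (1 - (1 - X₁) * δ / 2) ∩ Set.Ioo 0 1) ∧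
    (1 - (1 - X₁) * δ / 2) - X₁ * δ / 2 = 1 - δ / 2 := by
  refine ⟨fun m hm h => iSup_elog_of_lt hm h, fun m hm h => iSup_elog_of_gt hm h,
    iSup_elog_self, ?_, by ring⟩
  obtain ⟨hX0, hX1⟩ := hX
  have hlow : X₁ * δ ≤ X₁ := mul_le_of_le_one_right hX0 hδ1.le
  have hupp : (1 - X₁) * δ ≤ 1 - X₁ := mul_le_of_le_one_right (sub_nonneg.2 hX1) hδ1.le
  ext m
  rw [Set.mem_ofPred_eq, Set.mem_inter_iff, and_comm]
  refine and_congr_left fun hm => ?_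
  obtain ⟨hm0, hm1⟩ := id hm
  rw [Set.mem_Icc]
  rcases lt_trichotomy m X₁ with h | rfl | h
  · rw [iSup_elog_of_lt hm h, EReal.coe_le_coe_iff,
      log_div_le_log_div_iff (hm0.trans h) hm0 two_pos hδ0]
    exact ⟨fun _ => ⟨by linarith, by linarith⟩, fun ⟨_, _⟩ => by linarith⟩
  · rw [iSup_elog_self hm]
    exact iff_of_true
      (EReal.coe_nonneg.2 (Real.log_nonneg ((one_le_div hδ0).2 (by linarith))))
      ⟨by linarith, by linarith⟩
  · rw [iSup_elog_of_gt hm h, EReal.coe_le_coe_iff,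
      log_div_le_log_div_iff (by linarith) (sub_pos.2 hm1) two_pos hδ0]
    exact ⟨fun _ => ⟨by linarith, by linarith⟩, fun ⟨_, _⟩ => by linarith⟩
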